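/- There exist an injective group homomorphism ψ : ℤ → Homeo(C) such that ψ(n) is a prefix-exchange homeomorphism for every n ∈ ℤ, and a finite binary word w such that for all m, n ∈ ℤ, ψ(m)(w*) ∩ ψ(n)(w*) ≠ ∅ if and only if m = n. (In other words, ℤ embeds as a demonstrative subgroup of Thompson's group V with a demonstration node.) -/

import Mathlib

/-- The Cantor space `C = ℕ → Bool` with the product topology. -/
abbrev Cantor : Type := ℕ → Bool

/-- The sequence `u · y` beginning with the letters of the finite word `u` and
continuing with `y`. -/
def appendSeq (u : List Bool) (y : Cantor) : Cantor :=
  fun n => if h : n < u.length then u.get ⟨n, h⟩ else y (n - u.length)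

/-- The cylinder `u*`: all sequences of the form `u · y`. -/
def cylinder (u : List Bool) : Set Cantor :=
  Set.range (appendSeq u)

/-- The group of homeomorphisms of the Cantor space, with composition as
multiplication (`(f * g) x = f (g x)`). -/
instance : Group (Cantor ≃ₜ Cantor) where
  mul f g := g.trans f
  one := Homeomorph.refl _
  inv := Homeomorph.symm
  mul_assoc _ _ _ := Homeomorph.ext fun _ => rfl
  one_mul _ := Homeomorph.ext fun _ => rfl
  mul_one _ := Homeomorph.ext fun _ => rfl
  inv_mul_cancel f := Homeomorph.ext fun x => f.symm_apply_apply x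

/-- A homeomorphism of the Cantor space is a prefix-exchange homeomorphism if it is
given by finitely many prefix substitutions `uᵢ · y ↦ vᵢ · y`, where the cylinders
`uᵢ*` partition `C` and the cylinders `vᵢ*` partition `C`. -/
def IsPrefixExchange (f : Cantor ≃ₜ Cantor) : Prop :=
  ∃ n : ℕ, 1 ≤ n ∧ ∃ u v : Fin n → List Bool,
    (Set.univ : Set (Fin n)).PairwiseDisjoint (fun i => cylinder (u i)) ∧
    (⋃ i, cylinder (u i)) = Set.univ ∧
    (Set.univ : Set (Fin n)).PairwiseDisjoint (fun i => cylinder (v i)) ∧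
    (⋃ i, cylinder (v i)) = Set.univ ∧
    ∀ (i : Fin n) (y : Cantor), f (appendSeq (u i) y) = appendSeq (v i) y


lemma appendSeq_of_lt {u : List Bool} {n : ℕ} (h : n < u.length) (y : Cantor) :
    appendSeq u y n = u[n] := by
  simp [appendSeq, h]

lemma appendSeq_nil (y : Cantor) : appendSeq [] y = y := by
  ext n
  simp [appendSeq]

lemma appendSeq_cons_zero (a : Bool) (u : List Bool) (y : Cantor) :
    appendSeq (a :: u) y 0 = a := by
  simp [appendSeq]

lemma appendSeq_cons_succ (a : Bool) (u : List Bool) (y : Cantor) (n : ℕ) :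
    appendSeq (a :: u) y (n + 1) = appendSeq u y n := by
  simp [appendSeq]

lemma appendSeq_append (u v : List Bool) (y : Cantor) :
    appendSeq (u ++ v) y = appendSeq u (appendSeq v y) := by
  induction u with
  | nil => rw [List.nil_append, appendSeq_nil]
  | cons a u ih =>
    ext (_ | n)
    · simp only [List.cons_append, appendSeq_cons_zero]
    · simp only [List.cons_append, appendSeq_cons_succ, ih]

lemma appendSeq_ofFn (x : Cantor) (N : ℕ) :
    appendSeq (List.ofFn fun i : Fin N => x i) (fun n => x (n + N)) = x := by
  ext n
  by_cases h : n < N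
  · simp [appendSeq, h]
  · simp [appendSeq, h, Nat.sub_add_cancel (not_lt.mp h)]

lemma eq_of_appendSeq_eq {u v : List Bool} (hl : u.length = v.length) {y z : Cantor}
    (h : appendSeq u y = appendSeq v z) : u = v := by
  refine List.ext_getElem hl fun n hu hv => ?_
  rw [← appendSeq_of_lt hu y, h, appendSeq_of_lt hv]

/-- `f` acts as a prefix substitution on each cylinder of a word of length `N`. -/
def IsPrefixMapAtDepth (N : ℕ) (f : Cantor → Cantor) : Prop :=
  ∀ u : List Bool, u.length = N → ∃ v, ∀ y, f (appendSeq u y) = appendSeq v y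

lemma IsPrefixMapAtDepth.id : IsPrefixMapAtDepth 0 id :=
  fun u _ => ⟨u, fun _ => rfl⟩

lemma IsPrefixMapAtDepth.comp {M N : ℕ} {g f : Cantor → Cantor}
    (hg : IsPrefixMapAtDepth M g) (hf : IsPrefixMapAtDepth N f) :
    IsPrefixMapAtDepth (N + M) (g ∘ f) := by
  intro u hu
  obtain ⟨v, hv⟩ := hf (u.take N) (by simp [hu])
  set t := v ++ u.drop N with ht
  obtain ⟨v', hv'⟩ := hg (t.take M) (by simp [ht, hu])
  refine ⟨v' ++ t.drop M, fun y => ?_⟩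
  calc g (f (appendSeq u y))
      = g (f (appendSeq (u.take N ++ u.drop N) y)) := by rw [List.take_append_drop]
    _ = g (appendSeq (t.take M ++ t.drop M) y) := by
        rw [appendSeq_append, hv, List.take_append_drop, ht, appendSeq_append]
    _ = appendSeq (v' ++ t.drop M) y := by rw [appendSeq_append, hv', appendSeq_append]

lemma IsPrefixMapAtDepth.isPrefixExchange {N : ℕ} {f : Cantor ≃ₜ Cantor}
    (hf : IsPrefixMapAtDepth N f) : IsPrefixExchange f := by
  let e := (Fintype.equivFin (Fin N → Bool)).symm
  let u : Fin (Fintype.card (Fin N → Bool)) → List Bool := fun i => List.ofFn (e i)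
  have hu : ∀ i, (u i).length = N := fun i => by simp [u]
  choose v hv using fun i => hf (u i) (hu i)
  have himage : ∀ i, cylinder (v i) = f '' cylinder (u i) := fun i => by
    rw [cylinder, cylinder, ← Set.range_comp]
    exact congrArg Set.range (funext fun y => (hv i y).symm)
  have hdisj : ∀ i j, i ≠ j → Disjoint (cylinder (u i)) (cylinder (u j)) := by
    refine fun i j hij => Set.disjoint_left.mpr ?_
    rintro _ ⟨y, rfl⟩ ⟨z, hz⟩
    have huv := eq_of_appendSeq_eq ((hu i).trans (hu j).symm) hz.symm
    exact hij (e.injective (List.ofFn_injective huv))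
  have hcover : ⋃ i, cylinder (u i) = Set.univ := by
    refine Set.eq_univ_of_forall fun x => Set.mem_iUnion.mpr
      ⟨e.symm fun i => x i, fun n => x (n + N), ?_⟩
    simpa [u] using appendSeq_ofFn x N
  refine ⟨_, Fintype.card_pos, u, v, fun i _ j _ hij => hdisj i j hij, hcover,
    fun i _ j _ hij => ?_, ?_, hv⟩
  · simp only [Function.onFun, himage]
    exact (Set.disjoint_image_iff f.injective).mpr (hdisj i j hij)
  · simp only [himage, ← Set.image_iUnion, hcover, Set.image_univ, f.surjective.range_eq]

/-- The map `b · y ↦ bb · y`, `ab · y ↦ ba · y`, `aa · y ↦ a · y`, where `a = !b`.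
For `b = true` this is the standard generator `x₀` of Thompson's group `F`, and for
`b = false` its inverse. -/
def shiftToward (b : Bool) (x : Cantor) : Cantor := fun n =>
  if x 0 = b then x (n - 1) else if x 1 = b then x (Equiv.swap 0 1 n) else x (n + 1)

lemma continuous_shiftToward (b : Bool) : Continuous (shiftToward b) := by
  refine continuous_pi fun n => ?_
  let F : Bool × Bool × Bool × Bool × Bool → Bool := fun p =>
    if p.1 = b then p.2.2.1 else if p.2.1 = b then p.2.2.2.1 else p.2.2.2.2
  have hF : Continuous F := continuous_of_discreteTopology
  exact hF.comp (g := F) (f := fun x : Cantor =>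
    (x 0, x 1, x (n - 1), x (Equiv.swap 0 1 n), x (n + 1))) (by fun_prop)

lemma shiftToward_not_shiftToward (b : Bool) (x : Cantor) :
    shiftToward (!b) (shiftToward b x) = x := by
  ext n
  by_cases h0 : x 0 = b
  · simp [shiftToward, h0]
  · by_cases h1 : x 1 = b
    · simp [shiftToward, h0, h1]
    · replace h0 := Bool.eq_not.mpr h0
      replace h1 := Bool.eq_not.mpr h1
      rcases n with _ | n <;> simp [shiftToward, h0, h1]

lemma isPrefixMapAtDepth_shiftToward (b : Bool) : IsPrefixMapAtDepth 2 (shiftToward b) := by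
  intro u hu
  obtain ⟨a, c, rfl⟩ := List.length_eq_two.mp hu
  refine ⟨if a = b then [a, a, c] else if c = b then [c, a] else [c], fun y => ?_⟩
  ext n
  by_cases ha : a = b
  · rcases n with _ | _ | n <;>
      simp [shiftToward, ha, appendSeq_cons_zero, appendSeq_cons_succ]
  · by_cases hc : c = b
    · rcases n with _ | _ | n <;>
        simp [shiftToward, ha, hc, appendSeq_cons_zero, appendSeq_cons_succ, Equiv.swap_apply_def]
    · rcases n with _ | n <;>
        simp [shiftToward, ha, hc, appendSeq_cons_zero, appendSeq_cons_succ]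

/-- The generator `x₀` of Thompson's group `F`, acting on the Cantor space. -/
def shiftHomeo : Cantor ≃ₜ Cantor where
  toFun := shiftToward true
  invFun := shiftToward false
  left_inv := shiftToward_not_shiftToward true
  right_inv := shiftToward_not_shiftToward false
  continuous_toFun := continuous_shiftToward true
  continuous_invFun := continuous_shiftToward false

lemma Cantor.mul_apply (f g : Cantor ≃ₜ Cantor) (x : Cantor) : (f * g) x = f (g x) := rfl

lemma exists_isPrefixMapAtDepth_shiftHomeo_zpow (k : ℤ) :
    ∃ N, IsPrefixMapAtDepth N ⇑(shiftHomeo ^ k) := by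
  induction k with
  | zero => exact ⟨0, .id⟩
  | succ k ih =>
    obtain ⟨N, hN⟩ := ih
    rw [zpow_add_one]
    exact ⟨_, hN.comp (isPrefixMapAtDepth_shiftToward true)⟩
  | pred k ih =>
    obtain ⟨N, hN⟩ := ih
    rw [zpow_sub_one]
    exact ⟨_, hN.comp (isPrefixMapAtDepth_shiftToward false)⟩

/-- A positive power of `x₀` sends `01*` into `1*`. -/
lemma shiftHomeo_pow_succ_apply_zero {x : Cantor} (h1 : x 1 = true) (k : ℕ) :
    (shiftHomeo ^ (k + 1)) x 0 = true := by
  induction k with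
  | zero =>
    change shiftToward true x 0 = true
    by_cases h0 : x 0 = true <;> simp [shiftToward, h0, h1]
  | succ k ih =>
    rw [pow_succ', Cantor.mul_apply]
    change shiftToward true _ 0 = true
    simp [shiftToward, ih]

lemma eq_zero_of_shiftHomeo_zpow_mem {x : Cantor} {k : ℤ} (hx : x ∈ cylinder [false, true])
    (hk : (shiftHomeo ^ k) x ∈ cylinder [false, true]) : k = 0 := by
  have hcyl : ∀ z ∈ cylinder [false, true], z 0 = false ∧ z 1 = true := by
    rintro _ ⟨y, rfl⟩
    simp [appendSeq]
  have hpos : ∀ z w, z ∈ cylinder [false, true] → w ∈ cylinder [false, true] →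
      ∀ n : ℕ, (shiftHomeo ^ (n + 1)) z ≠ w := by
    rintro z _ hz hw n rfl
    simpa [shiftHomeo_pow_succ_apply_zero (hcyl z hz).2 n] using (hcyl _ hw).1
  obtain ⟨n, rfl | rfl⟩ := k.eq_nat_or_neg <;> rcases n with _ | n
  · rfl
  · rw [zpow_natCast] at hk
    exact (hpos _ _ hx hk n rfl).elim
  · rfl
  · refine (hpos _ _ hk hx n ?_).elim
    rw [← Cantor.mul_apply, ← zpow_natCast, ← zpow_add, add_neg_cancel]
    rfl

/-- `ℤ` embeds as a demonstrative subgroup of Thompson's group `V` (realized as the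
prefix-exchange homeomorphisms of the Cantor space), with a demonstration node `w*`. -/
theorem int_demonstrative_in_V :
    ∃ ψ : Multiplicative ℤ →* (Cantor ≃ₜ Cantor),
      Function.Injective ψ ∧
      (∀ n : Multiplicative ℤ, IsPrefixExchange (ψ n)) ∧
      ∃ w : List Bool, ∀ m n : Multiplicative ℤ,
        ((ψ m) '' cylinder w ∩ (ψ n) '' cylinder w).Nonempty ↔ m = n := by
  have hdem : ∀ m n : Multiplicative ℤ,
      ((zpowersHom _ shiftHomeo m) '' cylinder [false, true] ∩
        (zpowersHom _ shiftHomeo n) '' cylinder [false, true]).Nonempty ↔ m = n := by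
    refine fun m n => ⟨?_, ?_⟩
    · rintro ⟨_, ⟨x, hx, rfl⟩, y, hy, hxy⟩
      have hmn : zpowersHom _ shiftHomeo (n⁻¹ * m) x = y := by
        rw [map_mul, map_inv, Cantor.mul_apply, ← hxy]
        exact (zpowersHom _ shiftHomeo n).symm_apply_apply y
      rw [← hmn, zpowersHom_apply] at hy
      exact (inv_mul_eq_one.mp (eq_zero_of_shiftHomeo_zpow_mem hx hy)).symm
    · rintro rfl
      rw [Set.inter_self]
      exact (Set.range_nonempty _).image _
  refine ⟨zpowersHom _ shiftHomeo, fun m n h => (hdem m n).mp ?_, fun n => ?_, _, hdem⟩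
  · rw [h, Set.inter_self]
    exact (Set.range_nonempty _).image _
  · obtain ⟨N, hN⟩ := exists_isPrefixMapAtDepth_shiftHomeo_zpow n.toAdd
    exact hN.isPrefixExchange
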